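/- arXiv:2204.01174 — 2 statements merged into one kernel-verified Lean document; each statement's English description precedes it below -/
import Mathlib

section
/- Let U ⊆ ℂ^s be a connected open set containing 0 such that U ∩ ℝ^s is a neighbourhood of 0 in ℝ^s, and let Ω_1, …, Ω_s : U → M_n(ℂ) be holomorphic. If the Maurer–Cartan structure equation (∂Ω_β/∂z^α)(t) − (∂Ω_α/∂z^β)(t) = −[Ω_α(t), Ω_β(t)] holds for all α, β at every point t ∈ U ∩ ℝ^s, then it holds at every point z ∈ U. -/
attribute [local instance] Matrix.normedAddCommGroup Matrix.normedSpace

open Metric Set Filter Topology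

/-- First-order Taylor estimate for a holomorphic function on a disc with oscillation at most one
from its value at the centre. -/
lemma norm_sub_sub_smul_deriv_le {F : Type*} [NormedAddCommGroup F] [NormedSpace ℂ F]
    {φ : ℂ → F} {r : ℝ} (hd : DifferentiableOn ℂ φ (ball 0 r))
    (hb : ∀ w ∈ ball (0 : ℂ) r, ‖φ w - φ 0‖ ≤ 1) {w : ℂ} (hw : w ∈ ball (0 : ℂ) r) :
    ‖φ w - φ 0 - w • deriv φ 0‖ ≤ 2 * (‖w‖ / r) ^ 2 := by
  have hr : 0 < r := nonempty_ball.1 ⟨w, hw⟩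
  have hderiv : ‖deriv φ 0‖ ≤ 1 / r :=
    Complex.norm_deriv_le_div_of_mapsTo_ball hd
      (fun x hx => by simpa [dist_eq_norm_sub] using hb x hx) hr
  have key := Complex.dist_le_mul_div_pow_of_mapsTo_ball_of_isLittleO
    (f := fun x => φ x - x • deriv φ 0) (c := 0) (R₁ := r) (R₂ := 2) (n := 1) (z := w)
    (hd.sub (by fun_prop)) ?_ ?_ hw
  · rw [dist_eq_norm_sub] at key
    simpa [sub_right_comm] using key
  · intro x hx
    rw [mem_closedBall, dist_eq_norm_sub]
    have hx' : ‖x‖ ≤ r := by simpa using (mem_ball_zero_iff.1 hx).le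
    calc ‖φ x - x • deriv φ 0 - (φ 0 - (0 : ℂ) • deriv φ 0)‖
        = ‖(φ x - φ 0) - x • deriv φ 0‖ := by rw [zero_smul, sub_zero, sub_right_comm]
      _ ≤ ‖φ x - φ 0‖ + ‖x • deriv φ 0‖ := norm_sub_le _ _
      _ ≤ 1 + r * (1 / r) := by
          rw [norm_smul]
          gcongr
          exact hb x hx
      _ = 2 := by field_simp; norm_num
  · have h0 : HasDerivAt φ (deriv φ 0) 0 :=
      (hd.differentiableAt (ball_mem_nhds _ hr)).hasDerivAt
    have h1 := (hasDerivAt_iff_isLittleO.1 h0).norm_right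
    refine h1.congr (fun x => ?_) (fun x => by simp)
    simp [sub_right_comm]

/-- A directional derivative of a holomorphic map is holomorphic along complex lines. -/
lemma differentiableAt_fderiv_apply_line {E F : Type*} [NormedAddCommGroup E] [NormedSpace ℂ E]
    [NormedAddCommGroup F] [NormedSpace ℂ F] [CompleteSpace F] {f : E → F} {z : E}
    (hf : ∀ᶠ x in 𝓝 z, DifferentiableAt ℂ f x) (v e : E) :
    DifferentiableAt ℂ (fun t : ℂ => fderiv ℂ f (z + t • v) e) 0 := by
  have hcont : ∀ᶠ x in 𝓝 z, ‖f x - f z‖ < 1 / 2 := by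
    have := hf.self_of_nhds.continuousAt (ball_mem_nhds (f z) (by norm_num : (0 : ℝ) < 1 / 2))
    filter_upwards [this] with x hx
    simpa [dist_eq_norm_sub] using hx
  have htend : Tendsto (fun p : ℂ × ℂ => z + p.1 • v + p.2 • e) (𝓝 0) (𝓝 z) :=
    Continuous.tendsto' (by fun_prop) _ _ (by simp)
  obtain ⟨r, hr, hball⟩ := Metric.eventually_nhds_iff_ball.1 (htend.eventually (hf.and hcont))
  have hB : ∀ t ∈ ball (0 : ℂ) r, ∀ w ∈ ball (0 : ℂ) r,
      DifferentiableAt ℂ f (z + t • v + w • e) ∧ ‖f (z + t • v + w • e) - f z‖ < 1 / 2 := by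
    intro t ht w hw
    refine hball (t, w) ?_
    rw [← Prod.mk_zero_zero, ← ball_prod_same]
    exact ⟨ht, hw⟩
  have h0 : (0 : ℂ) ∈ ball (0 : ℂ) r := mem_ball_self hr
  have hB0 : ∀ t ∈ ball (0 : ℂ) r,
      DifferentiableAt ℂ f (z + t • v) ∧ ‖f (z + t • v) - f z‖ < 1 / 2 := by
    intro t ht
    simpa using hB t ht 0 h0
  have hest : ∀ t ∈ ball (0 : ℂ) r, ∀ w ∈ ball (0 : ℂ) r,
      ‖f (z + t • v + w • e) - f (z + t • v) - w • fderiv ℂ f (z + t • v) e‖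
        ≤ 2 * (‖w‖ / r) ^ 2 := by
    intro t ht w hw
    have hder : HasDerivAt (fun w : ℂ => f (z + t • v + w • e)) (fderiv ℂ f (z + t • v) e) 0 :=
      (hB0 t ht).1.hasFDerivAt.hasLineDerivAt e
    have := norm_sub_sub_smul_deriv_le (φ := fun w : ℂ => f (z + t • v + w • e)) (r := r)
      (fun x hx => ((hB t ht x hx).1.comp x
        (f := fun w : ℂ => z + t • v + w • e) (by fun_prop)).differentiableWithinAt)
      (fun x hx => by
        have h1 := (hB t ht x hx).2
        have h2 := (hB t ht 0 h0).2
        calc ‖f (z + t • v + x • e) - f (z + t • v + (0 : ℂ) • e)‖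
            ≤ ‖f (z + t • v + x • e) - f z‖ + ‖f (z + t • v + (0 : ℂ) • e) - f z‖ := by
              rw [← sub_sub_sub_cancel_right _ _ (f z)]
              exact norm_sub_le _ _
          _ ≤ 1 := by linarith) hw
    rw [hder.deriv] at this
    simpa using this
  have hunif : TendstoUniformlyOn
      (fun (w t : ℂ) => w⁻¹ • (f (z + t • v + w • e) - f (z + t • v)))
      (fun t => fderiv ℂ f (z + t • v) e) (𝓝[≠] 0) (ball 0 r) := by
    rw [Metric.tendstoUniformlyOn_iff]
    intro ε hε
    have hlim : Tendsto (fun w : ℂ => 2 * ‖w‖ / r ^ 2) (𝓝[≠] 0) (𝓝 0) :=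
      (Continuous.tendsto' (by fun_prop) _ _ (by simp)).mono_left nhdsWithin_le_nhds
    filter_upwards [hlim.eventually_lt_const hε, self_mem_nhdsWithin,
      nhdsWithin_le_nhds (ball_mem_nhds (0 : ℂ) hr)] with w hwε hw0 hw t ht
    have hw0 : w ≠ 0 := hw0
    have hwn : 0 < ‖w‖ := norm_pos_iff.2 hw0
    rw [dist_comm, dist_eq_norm_sub]
    refine lt_of_le_of_lt ?_ hwε
    have heq : w⁻¹ • (f (z + t • v + w • e) - f (z + t • v)) - fderiv ℂ f (z + t • v) e
        = w⁻¹ • (f (z + t • v + w • e) - f (z + t • v) - w • fderiv ℂ f (z + t • v) e) := by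
      rw [smul_sub w⁻¹ (_ - _), inv_smul_smul₀ hw0]
    rw [heq, norm_smul, norm_inv]
    calc ‖w‖⁻¹ * _ ≤ ‖w‖⁻¹ * (2 * (‖w‖ / r) ^ 2) := by
          gcongr
          exact hest t ht w hw
      _ = 2 * ‖w‖ / r ^ 2 := by field_simp
  have hdiff : DifferentiableOn ℂ (fun t : ℂ => fderiv ℂ f (z + t • v) e) (ball 0 r) := by
    refine hunif.tendstoLocallyUniformlyOn.differentiableOn ?_ isOpen_ball
    filter_upwards [nhdsWithin_le_nhds (ball_mem_nhds (0 : ℂ) hr)] with w hw t ht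
    have h1 : DifferentiableAt ℂ (fun t : ℂ => f (z + t • v + w • e)) t :=
      (hB t ht w hw).1.comp t (f := fun t : ℂ => z + t • v + w • e) (by fun_prop)
    have h2 : DifferentiableAt ℂ (fun t : ℂ => f (z + t • v)) t :=
      (hB0 t ht).1.comp t (f := fun t : ℂ => z + t • v) (by fun_prop)
    exact ((h1.sub h2).const_smul w⁻¹).differentiableWithinAt
  exact hdiff.differentiableAt (ball_mem_nhds _ hr)

section Identity

variable {E F : Type*} [NormedAddCommGroup E] [NormedSpace ℂ E]
  [NormedAddCommGroup F] [NormedSpace ℂ F]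

/-- A differentiable map is differentiable along complex lines. -/
lemma differentiableAt_comp_line {f : E → F} {z : E} (hf : DifferentiableAt ℂ f z) (v : E) :
    DifferentiableAt ℂ (fun t : ℂ => f (z + t • v)) 0 :=
  DifferentiableAt.comp (f := fun t : ℂ => z + t • v) 0 (by simpa using hf) (by fun_prop)

/-- Differentiability at the base point of every complex line gives differentiability at every
parameter of a line. -/
lemma differentiableAt_line_of_forall {G : E → F} {U : Set E}
    (hG : ∀ z ∈ U, ∀ v, DifferentiableAt ℂ (fun t : ℂ => G (z + t • v)) 0) {p v : E} {t : ℂ}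
    (ht : p + t • v ∈ U) : DifferentiableAt ℂ (fun x : ℂ => G (p + x • v)) t := by
  have h := hG _ ht v
  rw [← sub_self t] at h
  refine (h.comp t (f := fun x : ℂ => x - t) (by fun_prop)).congr_of_eventuallyEq
    (.of_forall fun x => ?_)
  simp only [Function.comp_apply, sub_smul]
  congr 1
  abel

/-- Identity theorem along a complex line inside a convex open set. -/
lemma eq_zero_of_frequently_eq_zero_line [CompleteSpace F] {G : E → F} {B : Set E}
    (hBo : IsOpen B) (hBc : Convex ℝ B)
    (hG : ∀ z ∈ B, ∀ v, DifferentiableAt ℂ (fun t : ℂ => G (z + t • v)) 0) {p v : E}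
    (hp : p ∈ B) (hfreq : ∃ᶠ t in 𝓝[≠] (0 : ℂ), G (p + t • v) = 0) {t : ℂ}
    (ht : p + t • v ∈ B) : G (p + t • v) = 0 := by
  have hopen : IsOpen {t : ℂ | p + t • v ∈ B} := hBo.preimage (by fun_prop)
  have hconv : Convex ℝ {t : ℂ | p + t • v ∈ B} := by
    intro x hx y hy a b ha hb hab
    have := hBc hx hy ha hb hab
    have heq : p + (a • x + b • y) • v = a • (p + x • v) + b • (p + y • v) := by
      rw [smul_add, smul_add, add_add_add_comm, ← add_smul a b p, hab, one_smul, add_smul,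
        smul_assoc, smul_assoc]
    rwa [← heq] at this
  have han : AnalyticOnNhd ℂ (fun t : ℂ => G (p + t • v)) {t : ℂ | p + t • v ∈ B} :=
    DifferentiableOn.analyticOnNhd
      (fun t ht => (differentiableAt_line_of_forall hG ht).differentiableWithinAt) hopen
  exact han.eqOn_zero_of_preconnected_of_frequently_eq_zero hconv.isPreconnected
    (by simpa using hp) hfreq ht

/-- Identity theorem for functions holomorphic along complex lines. -/
lemma eqOn_zero_of_differentiableAt_line [CompleteSpace F] {G : E → F} {U : Set E}
    (hU : IsOpen U) (hUc : IsPreconnected U)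
    (hG : ∀ z ∈ U, ∀ v, DifferentiableAt ℂ (fun t : ℂ => G (z + t • v)) 0) {z₀ : E}
    (hz₀ : z₀ ∈ U) (h : ∀ᶠ z in 𝓝 z₀, G z = 0) : ∀ z ∈ U, G z = 0 := by
  suffices hsub : U ⊆ {z | ∀ᶠ x in 𝓝 z, G x = 0} from fun z hz => (hsub hz).self_of_nhds
  refine hUc.subset_of_closure_inter_subset isOpen_setOfPred_eventually_nhds ⟨z₀, hz₀, h⟩ ?_
  rintro w ⟨hwcl, hwU⟩
  obtain ⟨r, hr, hrU⟩ := Metric.isOpen_iff.1 hU w hwU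
  obtain ⟨p, hp, hpw⟩ := Metric.mem_closure_iff.1 hwcl r hr
  filter_upwards [ball_mem_nhds w hr] with q hq
  have hline : Tendsto (fun t : ℂ => p + t • (q - p)) (𝓝[≠] 0) (𝓝 p) :=
    (Continuous.tendsto' (by fun_prop) _ _ (by simp)).mono_left nhdsWithin_le_nhds
  have := eq_zero_of_frequently_eq_zero_line (B := ball w r) isOpen_ball (convex_ball w r)
    (fun z hz => hG z (hrU hz)) (p := p) (v := q - p) (mem_ball'.2 hpw)
    (hline.eventually hp).frequently (t := 1) (by simpa using hq)
  simpa using this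

/-- A function on a polydisc, holomorphic along complex lines, that vanishes at the real points
vanishes identically. -/
lemma eq_zero_of_eq_zero_real [CompleteSpace F] {ι : Type*} [Fintype ι]
    {G : (ι → ℂ) → F} {r : ℝ}
    (hG : ∀ z ∈ ball (0 : ι → ℂ) r, ∀ v, DifferentiableAt ℂ (fun t : ℂ => G (z + t • v)) 0)
    (hreal : ∀ t : ι → ℝ, (fun i => (t i : ℂ)) ∈ ball (0 : ι → ℂ) r →
      G (fun i => (t i : ℂ)) = 0) :
    ∀ z ∈ ball (0 : ι → ℂ) r, G z = 0 := by
  classical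
  suffices H : ∀ S : Finset ι, ∀ z ∈ ball (0 : ι → ℂ) r, (∀ i ∉ S, ∃ x : ℝ, z i = x) → G z = 0 from
    fun z hz => H Finset.univ z hz (by simp)
  intro S
  induction S using Finset.induction_on with
  | empty =>
    intro z hz hzr
    choose x hx using fun i => hzr i (by simp)
    obtain rfl : z = fun i => (x i : ℂ) := funext hx
    exact hreal x hz
  | insert a S _ ih =>
    intro z hz hzr
    have hr : 0 < r := nonempty_ball.1 ⟨z, hz⟩
    have hupd : ∀ w : ℂ, Function.update z a 0 + w • Pi.single a (1 : ℂ)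
        = Function.update z a w := by
      intro w
      ext i
      by_cases hi : i = a
      · subst hi; simp
      · simp [hi]
    have hmem : ∀ w ∈ ball (0 : ℂ) r, Function.update z a w ∈ ball (0 : ι → ℂ) r := by
      intro w hw
      rw [mem_ball_zero_iff, pi_norm_lt_iff hr] at hz ⊢
      intro i
      by_cases hi : i = a
      · subst hi; simpa using hw
      · simpa [hi] using hz i
    have hzero : ∀ x : ℝ, (x : ℂ) ∈ ball (0 : ℂ) r → G (Function.update z a x) = 0 := by
      intro x hx
      refine ih _ (hmem _ hx) fun i hi => ?_
      by_cases hia : i = a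
      · subst hia; exact ⟨x, by simp⟩
      · simpa [hia] using hzr i (by simp [hi, hia])
    have hcoe : Tendsto (fun x : ℝ => (x : ℂ)) (𝓝[≠] 0) (𝓝[≠] 0) := by
      refine tendsto_nhdsWithin_iff.2 ⟨?_, ?_⟩
      · exact (Continuous.tendsto' Complex.continuous_ofReal _ _ (by simp)).mono_left
          nhdsWithin_le_nhds
      · filter_upwards [self_mem_nhdsWithin] with x hx
        simpa using hx
    have hfreq : ∃ᶠ w in 𝓝[≠] (0 : ℂ),
        G (Function.update z a 0 + w • Pi.single a (1 : ℂ)) = 0 := by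
      refine hcoe.frequently (Eventually.frequently ?_)
      filter_upwards [hcoe.eventually (nhdsWithin_le_nhds (ball_mem_nhds (0 : ℂ) hr))] with x hx
      rw [hupd]
      exact hzero x hx
    have hza : Function.update z a 0 + z a • Pi.single a (1 : ℂ) = z := by
      rw [hupd, Function.update_eq_self]
    have := eq_zero_of_frequently_eq_zero_line isOpen_ball (convex_ball (0 : ι → ℂ) r) hG
      (hmem 0 (mem_ball_self hr)) hfreq (t := z a) (by rwa [hza])
    rwa [hza] at this

end Identity

/-- Let `U ⊆ ℂˢ` be connected, open, containing `0`, with `U ∩ ℝˢ` a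
neighbourhood of `0` in `ℝˢ`, and let `Ω₁, …, Ωₛ : U → Mₙ(ℂ)` be holomorphic. If the
Maurer–Cartan equation holds at every real point of `U`, then it holds on all of `U`. -/
theorem stmt6 (n s : ℕ) (U : Set (Fin s → ℂ)) (hUopen : IsOpen U)
    (hUconn : IsConnected U) (hU0 : (0 : Fin s → ℂ) ∈ U)
    (hUnhds : {t : Fin s → ℝ | (fun μ => (t μ : ℂ)) ∈ U} ∈ nhds (0 : Fin s → ℝ))
    (Ω : Fin s → (Fin s → ℂ) → Matrix (Fin n) (Fin n) ℂ)
    (hΩdiff : ∀ (α : Fin s), ∀ z ∈ U, DifferentiableAt ℂ (Ω α) z)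
    (hMCreal : ∀ (α β : Fin s), ∀ t : Fin s → ℝ, (fun μ => (t μ : ℂ)) ∈ U →
      fderiv ℂ (Ω β) (fun μ => (t μ : ℂ)) (Pi.single α 1)
          - fderiv ℂ (Ω α) (fun μ => (t μ : ℂ)) (Pi.single β 1)
        = -(Ω α (fun μ => (t μ : ℂ)) * Ω β (fun μ => (t μ : ℂ))
            - Ω β (fun μ => (t μ : ℂ)) * Ω α (fun μ => (t μ : ℂ)))) :
    ∀ (α β : Fin s), ∀ z ∈ U,
      fderiv ℂ (Ω β) z (Pi.single α 1) - fderiv ℂ (Ω α) z (Pi.single β 1)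
        = -(Ω α z * Ω β z - Ω β z * Ω α z) := by
  intro α β
  have hev : ∀ γ, ∀ z ∈ U, ∀ᶠ x in 𝓝 z, DifferentiableAt ℂ (Ω γ) x := fun γ z hz => by
    filter_upwards [hUopen.mem_nhds hz] with x hx using hΩdiff γ x hx
  have hΩline : ∀ γ, ∀ z ∈ U, ∀ v i j, DifferentiableAt ℂ (fun t : ℂ => Ω γ (z + t • v) i j) 0 := by
    intro γ z hz v i j
    exact differentiableAt_pi.1 (differentiableAt_pi.1
      (differentiableAt_comp_line (hΩdiff γ z hz) v) i) j
  have hDline : ∀ γ e, ∀ z ∈ U, ∀ v i j,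
      DifferentiableAt ℂ (fun t : ℂ => fderiv ℂ (Ω γ) (z + t • v) e i j) 0 := by
    intro γ e z hz v i j
    exact differentiableAt_pi.1 (differentiableAt_pi.1
      (differentiableAt_fderiv_apply_line (hev γ z hz) v e) i) j
  suffices H : ∀ i j, ∀ z ∈ U,
      (fderiv ℂ (Ω β) z (Pi.single α 1) - fderiv ℂ (Ω α) z (Pi.single β 1)
        + (Ω α z * Ω β z - Ω β z * Ω α z)) i j = 0 by
    intro z hz
    rw [eq_neg_iff_add_eq_zero]
    ext i j
    exact H i j z hz
  intro i j
  let G : (Fin s → ℂ) → ℂ := fun z =>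
    (fderiv ℂ (Ω β) z (Pi.single α 1) - fderiv ℂ (Ω α) z (Pi.single β 1)
      + (Ω α z * Ω β z - Ω β z * Ω α z)) i j
  have hline : ∀ z ∈ U, ∀ v, DifferentiableAt ℂ (fun t : ℂ => G (z + t • v)) 0 := by
    intro z hz v
    simp only [G, Matrix.add_apply, Matrix.sub_apply, Matrix.mul_apply]
    refine ((hDline β _ z hz v i j).sub (hDline α _ z hz v i j)).add (.sub ?_ ?_)
    · exact .fun_sum fun k _ => (hΩline α z hz v i k).mul (hΩline β z hz v k j)
    · exact .fun_sum fun k _ => (hΩline β z hz v i k).mul (hΩline α z hz v k j)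
  obtain ⟨r, hr, hrU⟩ := Metric.isOpen_iff.1 hUopen 0 hU0
  refine eqOn_zero_of_differentiableAt_line (G := G) hUopen hUconn.isPreconnected hline hU0 ?_
  filter_upwards [ball_mem_nhds _ hr] with z hz
  refine eq_zero_of_eq_zero_real (G := G) (fun z hz => hline z (hrU hz)) (fun t ht => ?_) z hz
  have := hMCreal α β t (hrU ht)
  rw [eq_neg_iff_add_eq_zero] at this
  exact congrFun (congrFun this i) j
end

section
/- Let U be a complex vector space equipped with a conjugation σ : U → U, i.e. a conjugate-linear involution (σ(u + v) = σ(u) + σ(v), σ(c·u) = c̄·σ(u), σ∘σ = id). Let S ⊆ U be a complex subspace with S ∩ σ(S) = {0}, and let X_1, …, X_ℓ ∈ U be vectors such that the vectors X_1 + σ(X_1), …, X_ℓ + σ(X_ℓ) are linearly independent and their span intersects S + σ(S) only in {0}. On U × ℂ^ℓ define the conjugation σ'(u, z) := (σ(u), z̄) (coordinatewise complex conjugation on ℂ^ℓ), and let T ⊆ U × ℂ^ℓ be the complex subspace spanned by S × {0} together with the vectors Y_j := (X_j, i e_j), j = 1, …, ℓ, where e_1, …, e_ℓ is the standard basis of ℂ^ℓ.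 Then T ∩ σ'(T) = {0}. -/
/-- Membership in the span of `S × {0}` and the vectors `(Xⱼ, c eⱼ)`. -/
theorem exists_of_mem_span_graph {K U ι : Type*} [Field K] [AddCommGroup U] [Module K U]
    [Fintype ι] [DecidableEq ι] (S : Submodule K U) (X : ι → U) (c : K) {p : U × (ι → K)}
    (hp : p ∈ Submodule.span K (((fun u => (u, (0 : ι → K))) '' (S : Set U)) ∪
      Set.range fun j : ι => ((X j, Pi.single j c) : U × (ι → K)))) :
    ∃ s ∈ S, ∃ a : ι → K, p.1 = s + ∑ j, a j • X j ∧ ∀ j, p.2 j = a j * c := by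
  rw [Submodule.span_union, Submodule.mem_sup] at hp
  obtain ⟨y, hy, z, hz, rfl⟩ := hp
  have hspan : Submodule.span K ((fun u => (u, (0 : ι → K))) '' (S : Set U)) =
      S.map (LinearMap.inl K U (ι → K)) :=
    Submodule.span_eq (S.map (LinearMap.inl K U (ι → K)))
  rw [hspan] at hy
  obtain ⟨s, hs, rfl⟩ := hy
  obtain ⟨a, rfl⟩ := (Submodule.mem_span_range_iff_exists_fun K).1 hz
  refine ⟨s, hs, a, by simp [Prod.fst_sum], fun j => ?_⟩
  simp [Prod.snd_sum, Finset.sum_apply, Pi.single_apply]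


/-- Let `σ` be a conjugation on a complex vector space `U`, let `S` be a
complex subspace with `S ∩ σ(S) = {0}`, and let `X₁, …, X_ℓ` be such that the vectors
`Xⱼ + σ(Xⱼ)` are linearly independent and their span meets `S + σ(S)` only in `0`.
With `σ'(u, z) = (σ(u), z̄)` on `U × ℂˡ` and `T` the span of `S × {0}` together with the
`Yⱼ = (Xⱼ, i eⱼ)`, we have `T ∩ σ'(T) = {0}`. -/
theorem stmt8 (ℓ : ℕ) (U : Type*) [AddCommGroup U] [Module ℂ U]
    (σ : U → U)
    (hadd : ∀ u v : U, σ (u + v) = σ u + σ v)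
    (hsmul : ∀ (c : ℂ) (u : U), σ (c • u) = (starRingEnd ℂ) c • σ u)
    (hinv : ∀ u : U, σ (σ u) = u)
    (S : Submodule ℂ U)
    (hS : (S : Set U) ∩ (σ '' (S : Set U)) = {0})
    (X : Fin ℓ → U)
    (hXindep : LinearIndependent ℂ fun j => X j + σ (X j))
    (hXtrans : (Submodule.span ℂ (Set.range fun j => X j + σ (X j))
        ⊓ (S ⊔ Submodule.span ℂ (σ '' (S : Set U)))) = ⊥)
    (σ' : U × (Fin ℓ → ℂ) → U × (Fin ℓ → ℂ))
    (hσ' : ∀ p : U × (Fin ℓ → ℂ), σ' p = (σ p.1, fun j => (starRingEnd ℂ) (p.2 j)))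
    (T : Submodule ℂ (U × (Fin ℓ → ℂ)))
    (hT : T = Submodule.span ℂ
      (((fun u => (u, (0 : Fin ℓ → ℂ))) '' (S : Set U)) ∪
        Set.range fun j : Fin ℓ => ((X j, Pi.single j Complex.I) : U × (Fin ℓ → ℂ)))) :
    (T : Set (U × (Fin ℓ → ℂ))) ∩ (σ' '' (T : Set (U × (Fin ℓ → ℂ)))) = {0} := by
  let τ : U →ₛₗ[starRingEnd ℂ] U := { toFun := σ, map_add' := hadd, map_smul' := hsmul }
  have hτ : ∀ u, σ u = τ u := fun _ => rfl
  refine Set.eq_singleton_iff_unique_mem.2 ⟨⟨T.zero_mem, 0, T.zero_mem, ?_⟩, ?_⟩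
  · ext <;> simp [hσ', hτ]
  rintro p ⟨hp, q, hq, hqp⟩
  rw [hT] at hp hq
  obtain ⟨s, hs, a, hp1, hp2⟩ := exists_of_mem_span_graph S X Complex.I hp
  obtain ⟨t, ht, b, hq1, hq2⟩ := exists_of_mem_span_graph S X Complex.I hq
  rw [hσ'] at hqp
  have hab : ∀ j, (starRingEnd ℂ) (b j) = -a j := fun j => by
    have h := congrFun (congrArg Prod.snd hqp) j
    simp only [hp2, hq2, map_mul, Complex.conj_I] at h
    refine mul_right_cancel₀ Complex.I_ne_zero ?_
    linear_combination -h
  have h1 : σ t - ∑ j, a j • σ (X j) = s + ∑ j, a j • X j := by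
    have h := congrArg Prod.fst hqp
    simp only [hp1, hq1] at h
    rw [← h, hτ (t + _)]
    simp [hab, hτ, sub_eq_add_neg]
  have hsum : ∑ j, a j • (X j + σ (X j)) = σ t - s := by
    simp only [smul_add, Finset.sum_add_distrib]
    linear_combination (norm := module) -h1
  have hzero : ∑ j, a j • (X j + σ (X j)) = 0 := by
    rw [← Submodule.mem_bot ℂ, ← hXtrans]
    refine ⟨(Submodule.mem_span_range_iff_exists_fun ℂ).2 ⟨a, rfl⟩, ?_⟩
    rw [hsum]
    exact sub_mem (Submodule.mem_sup_right (Submodule.subset_span ⟨t, ht, rfl⟩))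
      (Submodule.mem_sup_left hs)
  have ha : ∀ j, a j = 0 := Fintype.linearIndependent_iff.1 hXindep a hzero
  have hst : σ t = s := sub_eq_zero.1 (hsum.symm.trans hzero)
  have hs0 : s = 0 := hS.subset ⟨hs, t, ht, hst⟩
  ext j
  · simp [hp1, hs0, ha]
  · simp [hp2, ha]
end
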